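/- Every based complex of finite-dimensional 𝔽₂-vector spaces with ordered bases admits a Curtis table. -/

import Mathlib

/-- The leading index (an element of `WithBot (Fin m)`, which is `⊥` exactly for the zero
vector) of a vector of the based `𝔽₂`-vector space `Fin m → ZMod 2`, whose ordered basis is
the standard one. -/
def lead {m : ℕ} (v : Fin m → ZMod 2) : WithBot (Fin m) :=
  (Finset.univ.filter fun j => v j ≠ 0).max

/-- `LTset S` is the set of leading indices of the nonzero elements of the subspace `S`. -/
def LTset {m : ℕ} (S : Submodule (ZMod 2) (Fin m → ZMod 2)) : Set (Fin m) :=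
  {j | ∃ v ∈ S, v ≠ 0 ∧ lead v = (j : WithBot (Fin m))}

/-- A based complex `X_0 → X_1 → ⋯ → X_N` of finite-dimensional `𝔽₂`-vector spaces with
ordered bases: `X_i` is modelled as `Fin (n i) → ZMod 2` via its ordered basis, and the
complex is extended by zero spaces in degrees `> N` (so `d_N = 0` holds automatically). -/
structure BasedComplex where
  N : ℕ
  n : ℕ → ℕ
  n_eq_zero : ∀ i, N < i → n i = 0
  d : ∀ i : ℕ, (Fin (n i) → ZMod 2) →ₗ[ZMod 2] (Fin (n (i + 1)) → ZMod 2)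
  d_comp : ∀ i, (d (i + 1)).comp (d i) = 0

namespace BasedComplex

/-- The cycles `ker d_i`. -/
def cyc (C : BasedComplex) (i : ℕ) : Submodule (ZMod 2) (Fin (C.n i) → ZMod 2) :=
  LinearMap.ker (C.d i)

/-- The boundaries `im d_{i-1}`, with the convention `d_{-1} = 0`. -/
def bdry (C : BasedComplex) : ∀ i : ℕ, Submodule (ZMod 2) (Fin (C.n i) → ZMod 2)
  | 0 => ⊥
  | (i + 1) => LinearMap.range (C.d i)

theorem bdry_zero (C : BasedComplex) : C.bdry 0 = ⊥ := rfl

theorem bdry_succ (C : BasedComplex) (i : ℕ) :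
    C.bdry (i + 1) = LinearMap.range (C.d i) := rfl

/-- The boundaries, viewed as a submodule of the cycles. -/
def bdryIn (C : BasedComplex) (i : ℕ) : Submodule (ZMod 2) (C.cyc i) :=
  (C.bdry i).comap (C.cyc i).subtype

/-- The homology `H_i = ker d_i / im d_{i-1}`. -/
abbrev homology (C : BasedComplex) (i : ℕ) :=
  C.cyc i ⧸ C.bdryIn i

end BasedComplex

/-- Given tag data `t`, where `t i k = some j` means that the basis index `k` of `X_i` is
tagged with target the basis index `j` of `X_{i+1}` (i.e. `τ_{i+1}(k) = j`),
`tagImage C t i` is the image of the partial function `τ_i` (which is empty for `i = 0`). -/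
def tagImage (C : BasedComplex) (t : ∀ i, Fin (C.n i) → Option (Fin (C.n (i + 1)))) :
    ∀ i : ℕ, Set (Fin (C.n i))
  | 0 => ∅
  | (i + 1) => {j | ∃ k, t i k = some j}

/-- A Curtis table for a based complex.  Here `t i` encodes the injective partial function
`τ_{i+1}` from the basis indices of `X_i` to the basis indices of `X_{i+1}`
(`t i k = some j` means `τ_{i+1}(k) = j`; the partial function `τ_0` is empty by
convention, and `τ_{N+1}` is automatically empty since `X_{N+1} = 0`). -/
structure CurtisTable (C : BasedComplex) where
  /-- the untagged items in each degree -/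
  U : ∀ i, Set (Fin (C.n i))
  /-- the tags -/
  t : ∀ i, Fin (C.n i) → Option (Fin (C.n (i + 1)))
  /-- the tags form an injective partial function -/
  t_inj : ∀ i k k' j, t i k = some j → t i k' = some j → k = k'
  /-- (i): `U_i` and the image of `τ_i` are disjoint … -/
  disj : ∀ i, Disjoint (U i) (tagImage C t i)
  /-- (i): … and their union is `LT(ker d_i)` -/
  union_eq : ∀ i, U i ∪ tagImage C t i = LTset (C.cyc i)
  /-- (ii): no index is both untagged and in the domain of `τ_{i+1}` -/
  mem_U_not_dom : ∀ i j, j ∈ U i → t i j = none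
  /-- (ii): no index is both in the image of `τ_i` and in the domain of `τ_{i+1}` -/
  mem_tagImage_not_dom : ∀ i j, j ∈ tagImage C t i → t i j = none
  /-- (ii): every basis index is untagged, or in the image of `τ_i`, or in the domain of
  `τ_{i+1}` -/
  cover : ∀ i j, j ∈ U i ∨ j ∈ tagImage C t i ∨ (t i j).isSome
  /-- (iii): if `τ_{i+1}(k) = j` then there is an `x` with leading index `k` such that
  `d_i x ≠ 0` and `d_i x` has leading index `j` -/
  tag_spec : ∀ i k j, t i k = some j →
    ∃ x : Fin (C.n i) → ZMod 2, lead x = (k : WithBot (Fin (C.n i))) ∧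
      C.d i x ≠ 0 ∧ lead (C.d i x) = (j : WithBot (Fin (C.n (i + 1))))

section Lead

variable {m p : ℕ}

theorem lead_lt_coe_iff {v : Fin m → ZMod 2} {j : Fin m} :
    lead v < (j : WithBot (Fin m)) ↔ ∀ i, j ≤ i → v i = 0 := by
  unfold lead
  rw [Finset.max_eq_sup_withBot, Finset.sup_lt_iff (WithBot.bot_lt_coe j)]
  simp only [Finset.mem_filter, Finset.mem_univ, true_and, WithBot.coe_lt_coe]
  exact forall_congr' fun i => by rw [← not_lt, not_imp_comm]

theorem lead_eq_coe_iff {v : Fin m → ZMod 2} {j : Fin m} :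
    lead v = (j : WithBot (Fin m)) ↔ v j ≠ 0 ∧ ∀ i, j < i → v i = 0 := by
  constructor
  · intro h
    refine ⟨(Finset.mem_filter.1 (Finset.mem_of_max h)).2, fun i hi => ?_⟩
    refine lead_lt_coe_iff.1 ?_ i le_rfl
    rw [h]
    exact WithBot.coe_lt_coe.2 hi
  · rintro ⟨hj, h⟩
    refine le_antisymm (Finset.max_le fun i hi => WithBot.coe_le_coe.2 ?_)
      (Finset.le_max (by simpa using hj))
    by_contra! hlt
    exact (Finset.mem_filter.1 hi).2 (h i hlt)

theorem lead_eq_bot_iff {v : Fin m → ZMod 2} : lead v = ⊥ ↔ v = 0 := by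
  unfold lead
  rw [Finset.max_eq_bot, Finset.filter_eq_empty_iff, funext_iff]
  simp

theorem lead_single (k : Fin m) : lead (Pi.single k 1) = (k : WithBot (Fin m)) :=
  lead_eq_coe_iff.2 ⟨by simp, fun _ hi => by simp [hi.ne']⟩

theorem lead_add_eq_right {x y : Fin m → ZMod 2} {k : Fin m}
    (hx : lead x < (k : WithBot (Fin m))) (hy : lead y = (k : WithBot (Fin m))) :
    lead (x + y) = (k : WithBot (Fin m)) := by
  rw [lead_lt_coe_iff] at hx
  rw [lead_eq_coe_iff] at hy ⊢
  refine ⟨by simpa [hx k le_rfl] using hy.1, fun i hi => ?_⟩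
  simp [hx i hi.le, hy.2 i hi]

/-- Over `𝔽₂`, leading terms at the same index cancel. -/
theorem lead_add_lt {x y : Fin m → ZMod 2} {k : Fin m}
    (hx : lead x = (k : WithBot (Fin m))) (hy : lead y = (k : WithBot (Fin m))) :
    lead (x + y) < (k : WithBot (Fin m)) := by
  rw [lead_eq_coe_iff] at hx hy
  rw [lead_lt_coe_iff]
  intro i hi
  obtain rfl | hi := hi.eq_or_lt
  · have key : ∀ a b : ZMod 2, a ≠ 0 → b ≠ 0 → a + b = 0 := by decide
    exact key _ _ hx.1 hy.1
  · simp [hx.2 i hi, hy.2 i hi]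

theorem exists_lead_map_minimal (f : (Fin m → ZMod 2) →ₗ[ZMod 2] (Fin p → ZMod 2))
    (k : Fin m) :
    ∃ x, lead x = (k : WithBot (Fin m)) ∧
      ∀ y, lead y = (k : WithBot (Fin m)) → lead (f x) ≤ lead (f y) := by
  obtain ⟨x, hx, hmin⟩ := Set.exists_min_image {x : Fin m → ZMod 2 | lead x = k}
    (fun x => lead (f x)) (Set.toFinite _) ⟨_, lead_single k⟩
  exact ⟨x, hx, hmin⟩

/-- Tagging each index `k` outside `LTset (ker f)` with the least leading index of `f x`, over
all `x` with leading index `k`, gives an injective partial function. -/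
theorem exists_tagging (f : (Fin m → ZMod 2) →ₗ[ZMod 2] (Fin p → ZMod 2)) :
    ∃ t : Fin m → Option (Fin p),
      (∀ k k' j, t k = some j → t k' = some j → k = k') ∧
      (∀ k, t k = none ↔ k ∈ LTset (LinearMap.ker f)) ∧
      ∀ k j, t k = some j → ∃ x, lead x = (k : WithBot (Fin m)) ∧ f x ≠ 0 ∧
        lead (f x) = (j : WithBot (Fin p)) := by
  choose x hx hmin using exists_lead_map_minimal f
  have hne : ∀ k, x k ≠ 0 := fun k h => by
    have := hx k
    rw [lead_eq_bot_iff.2 h] at this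
    exact WithBot.bot_ne_coe this
  have not_lt_of_lead_eq : ∀ k k' j, lead (f (x k)) = ((j : Fin p) : WithBot (Fin p)) →
      lead (f (x k')) = (j : WithBot (Fin p)) → ¬ k < k' := fun k k' j h h' hlt => by
    have hsum : lead (x k + x k') = (k' : WithBot (Fin m)) :=
      lead_add_eq_right (by rw [hx]; exact WithBot.coe_lt_coe.2 hlt) (hx k')
    have hle := hmin k' _ hsum
    rw [map_add, h'] at hle
    exact hle.not_gt (lead_add_lt h h')
  -- `WithBot (Fin p)` unfolds to `Option (Fin p)`.
  refine ⟨fun k => (lead (f (x k)) : WithBot (Fin p)), fun k k' j h h' => ?_, fun k => ?_,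
    fun k j h => ⟨x k, hx k, fun h0 => ?_, h⟩⟩
  · exact le_antisymm (not_lt.1 (not_lt_of_lead_eq k' k j h' h))
      (not_lt.1 (not_lt_of_lead_eq k k' j h h'))
  · refine ⟨fun h => ⟨x k, lead_eq_bot_iff.1 h, hne k, hx k⟩, ?_⟩
    rintro ⟨v, hv, -, hvk⟩
    have hle := hmin k v hvk
    rw [LinearMap.mem_ker.1 hv, lead_eq_bot_iff.2 rfl, le_bot_iff] at hle
    exact hle
  · exact WithBot.bot_ne_coe ((lead_eq_bot_iff.2 h0).symm.trans h)

end Lead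

/-- Every based complex of finite-dimensional `𝔽₂`-vector spaces with ordered bases admits
a Curtis table. -/
theorem exists_curtisTable (C : BasedComplex) : Nonempty (CurtisTable C) := by
  choose t t_inj t_none t_spec using fun i => exists_tagging (C.d i)
  have image_subset : ∀ i, tagImage C t i ⊆ LTset (C.cyc i) := by
    rintro (_ | i) j hj
    · exact hj.elim
    · obtain ⟨k, hk⟩ := hj
      obtain ⟨x, -, hx0, hxj⟩ := t_spec i k j hk
      exact ⟨C.d i x, LinearMap.congr_fun (C.d_comp i) x, hx0, hxj⟩
  exact ⟨{
    U := fun i => LTset (C.cyc i) \ tagImage C t i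
    t := t
    t_inj := t_inj
    disj := fun _ => Set.disjoint_sdiff_left
    union_eq := fun i => Set.sdiff_union_of_subset (image_subset i)
    mem_U_not_dom := fun i j hj => (t_none i j).2 hj.1
    mem_tagImage_not_dom := fun i j hj => (t_none i j).2 (image_subset i hj)
    cover := fun i j => by
      by_cases hj : j ∈ tagImage C t i
      · exact Or.inr (Or.inl hj)
      by_cases hk : j ∈ LTset (C.cyc i)
      · exact Or.inl ⟨hk, hj⟩
      · exact Or.inr (Or.inr (Option.isSome_iff_ne_none.2 fun h => hk ((t_none i j).1 h)))
    tag_spec := t_spec }⟩
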